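/- arXiv:1805.03150 — 6 statements merged into one kernel-verified Lean document; each statement's English description precedes it below -/
import Mathlib

section
/- Assume the rank-two H-like setup with dim Z ≥ 1, and suppose additionally that ⨆_{z ∈ Z} E(z) = V (no abelian factor). If the submodule ⨅_{z ≠ 0} E(z) is nonzero, then for every unit vector X₁ in ⨅_{z ≠ 0} E(z) and every orthonormal basis (Z₁, …, Z_p) of Z, the family (X₁, c⁻¹ • J(Z₁)X₁, …, c⁻¹ • J(Z_p)X₁) is an orthonormal basis of V; in particular dim V = dim Z + 1. Moreover, if dim Z ≥ 2 then ⨅_{z ≠ 0} E(z) is one-dimensional. (This identifies the algebra, up to homothetic isomorphism, as the almost abelian H-like metric Lie algebra n^p.) -/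
open Module

section CommonEigenvector

variable {Z V : Type*}
  [NormedAddCommGroup Z] [InnerProductSpace ℝ Z]
  [NormedAddCommGroup V] [InnerProductSpace ℝ V] [FiniteDimensional ℝ V]
  {c : ℝ} {J : Z →ₗ[ℝ] (V →ₗ[ℝ] V)}

theorem inner_apply_left_of_adjoint_eq_neg {A : V →ₗ[ℝ] V} (hA : LinearMap.adjoint A = -A)
    (x y : V) : inner ℝ (A x) y = -inner ℝ x (A y) := by
  rw [← LinearMap.adjoint_inner_left, hA]
  simp

theorem inner_apply_self_of_adjoint_eq_neg {A : V →ₗ[ℝ] V} (hA : LinearMap.adjoint A = -A)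
    (x : V) : inner ℝ x (A x) = 0 := by
  have h := inner_apply_left_of_adjoint_eq_neg hA x x
  rw [real_inner_comm] at h
  linarith

/-- A unit vector in every `range (J z)` makes `z ↦ J z X` a homothety with factor `c`. -/
theorem inner_apply_apply_of_mem_iInf_range
    (hskew : ∀ z : Z, LinearMap.adjoint (J z) = -(J z))
    (hcube : ∀ z : Z, (J z) ∘ₗ (J z) ∘ₗ (J z) = -((c ^ 2 * ‖z‖ ^ 2) • (J z)))
    {X : V} (hX : ‖X‖ = 1) (hmem : X ∈ ⨅ (z : Z) (_ : z ≠ 0), LinearMap.range (J z))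
    (z w : Z) : inner ℝ (J z X) (J w X) = c ^ 2 * inner ℝ z w := by
  have hnorm : ∀ z : Z, ‖J z X‖ ^ 2 = c ^ 2 * ‖z‖ ^ 2 := by
    intro z
    by_cases hz : z = 0
    · simp [hz]
    simp only [Submodule.mem_iInf] at hmem
    obtain ⟨y, rfl⟩ := hmem z hz
    have h := LinearMap.congr_fun (hcube z) y
    simp only [LinearMap.comp_apply, LinearMap.neg_apply, LinearMap.smul_apply] at h
    rw [← real_inner_self_eq_norm_sq, inner_apply_left_of_adjoint_eq_neg (hskew z), h,
      inner_neg_right, real_inner_smul_right, real_inner_self_eq_norm_sq, hX]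
    ring
  have h := hnorm (z + w)
  rw [map_add, LinearMap.add_apply, norm_add_sq_real, norm_add_sq_real, hnorm, hnorm] at h
  linarith

theorem orthonormal_cons_of_mem_iInf_range (hc : 0 < c)
    (hskew : ∀ z : Z, LinearMap.adjoint (J z) = -(J z))
    (hcube : ∀ z : Z, (J z) ∘ₗ (J z) ∘ₗ (J z) = -((c ^ 2 * ‖z‖ ^ 2) • (J z)))
    {X : V} (hX : ‖X‖ = 1) (hmem : X ∈ ⨅ (z : Z) (_ : z ≠ 0), LinearMap.range (J z))
    {n : ℕ} {b : Fin n → Z} (hb : Orthonormal ℝ b) :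
    Orthonormal ℝ (Fin.cons X (fun i => c⁻¹ • (J (b i)) X) : Fin (n + 1) → V) := by
  have hperp : ∀ z, inner ℝ X (J z X) = 0 := fun z =>
    inner_apply_self_of_adjoint_eq_neg (hskew z) X
  rw [orthonormal_iff_ite] at hb ⊢
  intro i j
  refine Fin.cases ?_ (fun i => ?_) i <;> refine Fin.cases ?_ (fun j => ?_) j
  · simp [hX]
  · simp [real_inner_smul_right, hperp, (Fin.succ_ne_zero j).symm]
  · rw [real_inner_comm]
    simp [real_inner_smul_right, hperp, Fin.succ_ne_zero i]
  · simp only [Fin.cons_succ, real_inner_smul_left, real_inner_smul_right, Fin.succ_inj,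
      inner_apply_apply_of_mem_iInf_range hskew hcube hX hmem, hb]
    field_simp

theorem range_eq_span_pair_of_mem_iInf_range (hc : 0 < c)
    (hskew : ∀ z : Z, LinearMap.adjoint (J z) = -(J z))
    (hcube : ∀ z : Z, (J z) ∘ₗ (J z) ∘ₗ (J z) = -((c ^ 2 * ‖z‖ ^ 2) • (J z)))
    (hrank : ∀ z : Z, z ≠ 0 → finrank ℝ (LinearMap.range (J z)) = 2)
    {X : V} (hX : ‖X‖ = 1) (hmem : X ∈ ⨅ (z : Z) (_ : z ≠ 0), LinearMap.range (J z))
    {z : Z} (hz : z ≠ 0) : LinearMap.range (J z) = Submodule.span ℝ {X, J z X} := by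
  have hperp := inner_apply_self_of_adjoint_eq_neg (hskew z) X
  have hsq := inner_apply_apply_of_mem_iInf_range hskew hcube hX hmem z z
  have hli : LinearIndependent ℝ ![X, J z X] := by
    refine linearIndependent_of_ne_zero_of_inner_eq_zero ?_ ?_
    · refine Fin.forall_fin_two.2 ⟨?_, ?_⟩
      · exact norm_ne_zero_iff.1 (by simp [hX])
      · intro h
        simp only [Matrix.cons_val_one, Matrix.cons_val_zero] at h
        simp [h, hc.ne', hz] at hsq
    · intro i j hij
      fin_cases i <;> fin_cases j <;> simp_all [real_inner_comm]
  symm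
  apply Submodule.eq_of_le_of_finrank_eq
  · rw [Submodule.span_le, Set.insert_subset_iff, Set.singleton_subset_iff]
    simp only [Submodule.mem_iInf] at hmem
    exact ⟨hmem z hz, X, rfl⟩
  · have h := finrank_span_eq_card hli
    rw [Matrix.range_cons, Matrix.range_cons, Matrix.range_empty, Set.union_empty,
      Set.singleton_union] at h
    rw [h, hrank z hz, Fintype.card_fin]

theorem span_cons_eq_top_of_mem_iInf_range (hc : 0 < c)
    (hskew : ∀ z : Z, LinearMap.adjoint (J z) = -(J z))
    (hcube : ∀ z : Z, (J z) ∘ₗ (J z) ∘ₗ (J z) = -((c ^ 2 * ‖z‖ ^ 2) • (J z)))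
    (hrank : ∀ z : Z, z ≠ 0 → finrank ℝ (LinearMap.range (J z)) = 2)
    (hsup : (⨆ z : Z, LinearMap.range (J z)) = ⊤)
    {X : V} (hX : ‖X‖ = 1) (hmem : X ∈ ⨅ (z : Z) (_ : z ≠ 0), LinearMap.range (J z))
    {n : ℕ} (b : OrthonormalBasis (Fin n) ℝ Z) :
    Submodule.span ℝ
      (Set.range (Fin.cons X (fun i => c⁻¹ • (J (b i)) X) : Fin (n + 1) → V)) = ⊤ := by
  rw [eq_top_iff, ← hsup, iSup_le_iff]
  intro z
  by_cases hz : z = 0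
  · simp [hz]
  rw [range_eq_span_pair_of_mem_iInf_range hc hskew hcube hrank hX hmem hz, Submodule.span_le,
    Set.insert_subset_iff, Set.singleton_subset_iff]
  refine ⟨Submodule.subset_span ⟨0, rfl⟩, ?_⟩
  rw [← b.sum_repr z, map_sum, LinearMap.sum_apply]
  refine Submodule.sum_mem _ fun i _ => ?_
  have h : (J (b.repr z i • b i)) X = (b.repr z i * c) • (c⁻¹ • (J (b i)) X) := by
    rw [map_smul, LinearMap.smul_apply, smul_smul, mul_assoc, mul_inv_cancel₀ hc.ne', mul_one]
  rw [h]
  exact Submodule.smul_mem _ _ (Submodule.subset_span ⟨i.succ, rfl⟩)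

theorem iInf_range_eq_span_singleton (hc : 0 < c)
    (hskew : ∀ z : Z, LinearMap.adjoint (J z) = -(J z))
    (hcube : ∀ z : Z, (J z) ∘ₗ (J z) ∘ₗ (J z) = -((c ^ 2 * ‖z‖ ^ 2) • (J z)))
    (hrank : ∀ z : Z, z ≠ 0 → finrank ℝ (LinearMap.range (J z)) = 2)
    {X : V} (hX : ‖X‖ = 1) (hmem : X ∈ ⨅ (z : Z) (_ : z ≠ 0), LinearMap.range (J z))
    {z w : Z} (hz : z ≠ 0) (hw : w ≠ 0) (hzw : inner ℝ z w = 0) :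
    (⨅ (z : Z) (_ : z ≠ 0), LinearMap.range (J z)) = Submodule.span ℝ {X} := by
  refine le_antisymm (fun y hy => ?_) ((Submodule.span_singleton_le_iff_mem _ _).2 hmem)
  have hrange : ∀ u : Z, u ≠ 0 → ∃ r s : ℝ, r • X + s • J u X = y := by
    intro u hu
    simp only [Submodule.mem_iInf] at hy
    have h := hy u hu
    rwa [range_eq_span_pair_of_mem_iInf_range hc hskew hcube hrank hX hmem hu,
      Submodule.mem_span_pair] at h
  obtain ⟨r, s, hrs⟩ := hrange z hz
  obtain ⟨r', s', hrs'⟩ := hrange w hw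
  have hs : s = 0 := by
    have h := congrArg (inner ℝ (J z X)) (hrs.trans hrs'.symm)
    have hperp : inner ℝ (J z X) X = 0 := by
      rw [real_inner_comm, inner_apply_self_of_adjoint_eq_neg (hskew z)]
    have hzz : inner ℝ z z ≠ 0 := inner_self_ne_zero.2 hz
    simpa [inner_add_right, real_inner_smul_right, hperp, hzw, hc.ne', hzz,
      -inner_self_eq_norm_sq_to_K, inner_apply_apply_of_mem_iInf_range hskew hcube hX hmem] using h
  rw [Submodule.mem_span_singleton]
  exact ⟨r, by simpa [hs] using hrs⟩

end CommonEigenvector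

/-- **Rank-two H-like algebras with common eigenvector: the almost abelian case.**
`J` encodes an H-like metric two-step nilpotent Lie algebra of `J`-rank two with
constant `J`-spectrum `{ic, -ic, 0, …, 0}` (each `J z` skew-adjoint,
`(J z)³ = -(c²‖z‖²) • (J z)`, rank `2` for `z ≠ 0`); `E z = range (J z)`.
Assume `dim Z ≥ 1` and `⨆ z, E z = V` (no abelian factor).  If `⨅_{z ≠ 0} E z ≠ ⊥`,
then for every unit `X₁ ∈ ⨅_{z ≠ 0} E z` and every orthonormal basis
`(Z₁, …, Z_p)` of `Z`, the family `(X₁, c⁻¹ • J Z₁ X₁, …, c⁻¹ • J Z_p X₁)` is an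
orthonormal basis of `V`; in particular `dim V = dim Z + 1`.  Moreover if
`dim Z ≥ 2` then `⨅_{z ≠ 0} E z` is one-dimensional.  (This identifies the
algebra, up to homothety, as the almost abelian H-like algebra `n^p`.) -/
theorem stmt2 {Z V : Type*}
    [NormedAddCommGroup Z] [InnerProductSpace ℝ Z] [FiniteDimensional ℝ Z]
    [NormedAddCommGroup V] [InnerProductSpace ℝ V] [FiniteDimensional ℝ V]
    (c : ℝ) (hc : 0 < c) (J : Z →ₗ[ℝ] (V →ₗ[ℝ] V))
    (hskew : ∀ z : Z, LinearMap.adjoint (J z) = -(J z))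
    (hcube : ∀ z : Z, (J z) ∘ₗ (J z) ∘ₗ (J z) = -((c ^ 2 * ‖z‖ ^ 2) • (J z)))
    (hrank : ∀ z : Z, z ≠ 0 → finrank ℝ (LinearMap.range (J z)) = 2)
    (hp : 1 ≤ finrank ℝ Z)
    (hsup : (⨆ z : Z, LinearMap.range (J z)) = ⊤)
    (hinf : (⨅ (z : Z) (_ : z ≠ 0), LinearMap.range (J z)) ≠ ⊥) :
    (∀ X₁ : V, ‖X₁‖ = 1 → X₁ ∈ (⨅ (z : Z) (_ : z ≠ 0), LinearMap.range (J z)) →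
      ∀ b : OrthonormalBasis (Fin (finrank ℝ Z)) ℝ Z,
        Orthonormal ℝ (Fin.cons X₁ (fun i => c⁻¹ • (J (b i)) X₁) :
          Fin (finrank ℝ Z + 1) → V) ∧
        Submodule.span ℝ
          (Set.range (Fin.cons X₁ (fun i => c⁻¹ • (J (b i)) X₁) :
            Fin (finrank ℝ Z + 1) → V)) = ⊤) ∧
    finrank ℝ V = finrank ℝ Z + 1 ∧
    (2 ≤ finrank ℝ Z →
      finrank ℝ ↥(⨅ (z : Z) (_ : z ≠ 0), LinearMap.range (J z)) = 1) := by
  obtain ⟨Y, hY, hY0⟩ := Submodule.exists_mem_ne_zero_of_ne_bot hinf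
  obtain ⟨X, hX, hmem⟩ : ∃ X : V, ‖X‖ = 1 ∧
      X ∈ ⨅ (z : Z) (_ : z ≠ 0), LinearMap.range (J z) :=
    ⟨‖Y‖⁻¹ • Y, norm_smul_inv_norm (𝕜 := ℝ) hY0, Submodule.smul_mem _ _ hY⟩
  refine ⟨fun X₁ hX₁ hmem₁ b => ⟨orthonormal_cons_of_mem_iInf_range hc hskew hcube hX₁ hmem₁
    b.orthonormal,
    span_cons_eq_top_of_mem_iInf_range hc hskew hcube hrank hsup hX₁ hmem₁ b⟩, ?_, fun h2 => ?_⟩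
  · have h := finrank_span_eq_card (orthonormal_cons_of_mem_iInf_range hc hskew hcube hX hmem
      (stdOrthonormalBasis ℝ Z).orthonormal).linearIndependent
    rwa [span_cons_eq_top_of_mem_iInf_range hc hskew hcube hrank hsup hX hmem, finrank_top,
      Fintype.card_fin] at h
  · have hb := (stdOrthonormalBasis ℝ Z).orthonormal
    have hne : (⟨0, by omega⟩ : Fin (finrank ℝ Z)) ≠ ⟨1, by omega⟩ := by simp
    rw [iInf_range_eq_span_singleton hc hskew hcube hrank hX hmem (hb.ne_zero _) (hb.ne_zero _)
      (hb.2 hne)]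
    exact finrank_span_singleton (norm_ne_zero_iff.1 (by simp [hX]))
end

section
/- Assume the rank-two H-like setup with dim Z ≥ 1, and suppose additionally that ⨆_{z ∈ Z} E(z) = V (no abelian factor). If ⨅_{z ≠ 0} E(z) = {0}, then dim Z = 3 and dim V = 3. (Together with the resulting bracket relations this identifies the algebra, up to homothetic isomorphism, as the free two-step nilpotent Lie algebra on three generators with its standard H-like inner product.) -/
open Module

section SkewRankTwo

variable {V : Type*} [NormedAddCommGroup V] [InnerProductSpace ℝ V] [FiniteDimensional ℝ V]

/-- Skew-adjointness in terms of the inner product. -/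
lemma inner_skew {T : V →ₗ[ℝ] V} (hT : LinearMap.adjoint T = -T) (x y : V) :
    inner ℝ (T x) y = -inner ℝ x (T y) := by
  rw [← LinearMap.adjoint_inner_right, hT, LinearMap.neg_apply, inner_neg_right]

lemma inner_skew_self {T : V →ₗ[ℝ] V} (hT : LinearMap.adjoint T = -T) (x : V) :
    inner ℝ (T x) x = 0 := by
  have h := inner_skew hT x x
  rw [real_inner_comm (T x) x] at h
  linarith

lemma inner_eq_zero_of_mem_ker_of_mem_range {T : V →ₗ[ℝ] V} (hT : LinearMap.adjoint T = -T)
    {x y : V} (hx : T x = 0) (hy : y ∈ LinearMap.range T) : inner ℝ x y = 0 := by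
  obtain ⟨v, rfl⟩ := hy
  have h := inner_skew hT x v
  rw [hx, inner_zero_left] at h
  linarith

/-- If the sum of two skew-adjoint maps of rank two has rank at most two, their ranges meet
nontrivially. -/
lemma exists_ne_zero_mem_range_of_skew {S T : V →ₗ[ℝ] V}
    (hS : LinearMap.adjoint S = -S) (hT : LinearMap.adjoint T = -T)
    (hS2 : finrank ℝ (LinearMap.range S) = 2) (hT2 : finrank ℝ (LinearMap.range T) = 2)
    (hST : finrank ℝ (LinearMap.range (S + T)) ≤ 2) :
    ∃ x, x ≠ 0 ∧ x ∈ LinearMap.range S ∧ x ∈ LinearMap.range T := by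
  by_contra! hcon
  have hker : LinearMap.ker (S + T) ≤ (LinearMap.range S ⊔ LinearMap.range T)ᗮ := by
    intro v hv
    have hv' : S v + T v = 0 := hv
    have hSv : S v = 0 := by
      by_contra hne
      exact hcon _ hne ⟨v, rfl⟩ ⟨-v, by rw [map_neg, eq_neg_of_add_eq_zero_left hv']⟩
    have hTv : T v = 0 := by rwa [hSv, zero_add] at hv'
    rw [Submodule.mem_orthogonal']
    intro u hu
    obtain ⟨x, hx, y, hy, rfl⟩ := Submodule.mem_sup.1 hu
    rw [inner_add_right, inner_eq_zero_of_mem_ker_of_mem_range hS hSv hx,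
      inner_eq_zero_of_mem_ker_of_mem_range hT hTv hy, add_zero]
  have hinf : LinearMap.range S ⊓ LinearMap.range T = ⊥ := by
    rw [Submodule.eq_bot_iff]
    intro x hx
    by_contra hne
    exact hcon x hne hx.1 hx.2
  have h1 := Submodule.finrank_sup_add_finrank_inf_eq (LinearMap.range S) (LinearMap.range T)
  rw [hinf, finrank_bot] at h1
  have h2 := Submodule.finrank_mono hker
  have h3 := Submodule.finrank_add_finrank_orthogonal (LinearMap.range S ⊔ LinearMap.range T)
  have h4 := LinearMap.finrank_range_add_finrank_ker (S + T)
  omega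

/-- Two vectors lying both in a plane and in a subspace not containing the plane are
proportional. -/
lemma exists_eq_smul_of_plane_not_le {P S : Submodule ℝ V} (hP : finrank ℝ P = 2)
    (hPS : ¬ P ≤ S) {x y : V} (hxP : x ∈ P) (hxS : x ∈ S) (hyP : y ∈ P) (hyS : y ∈ S)
    (hx : x ≠ 0) : ∃ t : ℝ, y = t • x := by
  by_contra! hcon
  have hli : LinearIndependent ℝ ![x, y] :=
    (LinearIndependent.pair_iff' hx).2 fun t h => hcon t h.symm
  have hle : Submodule.span ℝ (Set.range ![x, y]) ≤ P := by
    rw [Submodule.span_le]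
    rintro _ ⟨i, rfl⟩
    fin_cases i <;> simpa
  have heq := Submodule.eq_of_le_of_finrank_eq hle (by rw [finrank_span_eq_card hli, hP]; simp)
  apply hPS
  rw [← heq, Submodule.span_le]
  rintro _ ⟨i, rfl⟩
  fin_cases i <;> simpa

/-- A skew-adjoint map on a three-dimensional space vanishes if its three independent matrix
entries do. -/
lemma skew_eq_zero_of_basis (b : Basis (Fin 3) ℝ V) {T : V →ₗ[ℝ] V}
    (hT : LinearMap.adjoint T = -T) (h12 : inner ℝ (T (b 1)) (b 2) = 0)
    (h20 : inner ℝ (T (b 2)) (b 0) = 0) (h01 : inner ℝ (T (b 0)) (b 1) = 0) : T = 0 := by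
  have hs : ∀ x y : V, inner ℝ (T x) y = 0 → inner ℝ (T y) x = 0 := by
    intro x y h
    rw [inner_skew hT, real_inner_comm, h, neg_zero]
  refine b.ext fun i => ?_
  rw [LinearMap.zero_apply]
  refine InnerProductSpace.ext_inner_right_basis b fun j => ?_
  rw [inner_zero_left]
  fin_cases i <;> fin_cases j <;>
    first
    | exact inner_skew_self hT _
    | assumption
    | (apply hs; assumption)

end SkewRankTwo

/-- **Rank-two H-like algebras with no common eigenvector: the free case.**
`J` encodes an H-like metric two-step nilpotent Lie algebra of `J`-rank two with
constant `J`-spectrum `{ic, -ic, 0, …, 0}` (each `J z` skew-adjoint,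
`(J z)³ = -(c²‖z‖²) • (J z)`, rank `2` for `z ≠ 0`); `E z = range (J z)`.
Assume `dim Z ≥ 1` and `⨆ z, E z = V` (no abelian factor).  If
`⨅_{z ≠ 0} E z = ⊥`, then `dim Z = 3` and `dim V = 3`.  (Together with the
bracket relations this identifies the algebra, up to homothety, as the free
two-step nilpotent Lie algebra on three generators with its standard H-like
inner product.) -/
theorem stmt3 {Z V : Type*}
    [NormedAddCommGroup Z] [InnerProductSpace ℝ Z] [FiniteDimensional ℝ Z]
    [NormedAddCommGroup V] [InnerProductSpace ℝ V] [FiniteDimensional ℝ V]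
    (c : ℝ) (hc : 0 < c) (J : Z →ₗ[ℝ] (V →ₗ[ℝ] V))
    (hskew : ∀ z : Z, LinearMap.adjoint (J z) = -(J z))
    (hcube : ∀ z : Z, (J z) ∘ₗ (J z) ∘ₗ (J z) = -((c ^ 2 * ‖z‖ ^ 2) • (J z)))
    (hrank : ∀ z : Z, z ≠ 0 → finrank ℝ (LinearMap.range (J z)) = 2)
    (hp : 1 ≤ finrank ℝ Z)
    (hsup : (⨆ z : Z, LinearMap.range (J z)) = ⊤)
    (hinf : (⨅ (z : Z) (_ : z ≠ 0), LinearMap.range (J z)) = ⊥) :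
    finrank ℝ Z = 3 ∧ finrank ℝ V = 3 := by
  have hE : ∀ z w : Z, z ≠ 0 → w ≠ 0 →
      ∃ x, x ≠ 0 ∧ x ∈ LinearMap.range (J z) ∧ x ∈ LinearMap.range (J w) := by
    intro z w hz hw
    refine exists_ne_zero_mem_range_of_skew (hskew z) (hskew w) (hrank z hz) (hrank w hw) ?_
    rw [← map_add]
    by_cases h : z + w = 0
    · rw [h, map_zero, LinearMap.range_zero, finrank_bot]
      omega
    · exact (hrank _ h).le
  have hcommon : ∀ x : V, x ≠ 0 → ∃ z, z ≠ 0 ∧ x ∉ LinearMap.range (J z) := by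
    intro x hx
    by_contra! hcon
    have hmem : x ∈ (⨅ (z : Z) (_ : z ≠ 0), LinearMap.range (J z)) := by
      simp only [Submodule.mem_iInf]
      exact hcon
    rw [hinf] at hmem
    exact hx hmem
  have hplane : ∀ z w : Z, z ≠ 0 → w ≠ 0 → ∀ u ∈ LinearMap.range (J z),
      u ∉ LinearMap.range (J w) → ∀ x y : V, x ∈ LinearMap.range (J z) →
      x ∈ LinearMap.range (J w) → y ∈ LinearMap.range (J z) → y ∈ LinearMap.range (J w) →
      x ≠ 0 → ∃ t : ℝ, y = t • x := fun z w hz _ u hu hu' x y h1 h2 h3 h4 hx =>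
    exists_eq_smul_of_plane_not_le (hrank z hz) (fun hle => hu' (hle hu)) h1 h2 h3 h4 hx
  have : Nontrivial Z := Module.finrank_pos_iff.1 hp
  obtain ⟨z₀, hz₀⟩ := exists_ne (0 : Z)
  obtain ⟨u, hu, hu₀, -⟩ := hE z₀ z₀ hz₀ hz₀
  obtain ⟨z₁, hz₁, hu₁⟩ := hcommon u hu
  obtain ⟨a₂, ha₂, ha₂0, ha₂1⟩ := hE z₀ z₁ hz₀ hz₁
  obtain ⟨z₂, hz₂, ha₂2⟩ := hcommon a₂ ha₂
  obtain ⟨a₁, ha₁, ha₁0, ha₁2⟩ := hE z₀ z₂ hz₀ hz₂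
  obtain ⟨a₀, ha₀, ha₀1, ha₀2⟩ := hE z₁ z₂ hz₁ hz₂
  have hno : ∀ x, x ∈ LinearMap.range (J z₀) → x ∈ LinearMap.range (J z₁) →
      x ∈ LinearMap.range (J z₂) → x = 0 := by
    intro x h0 h1 h2
    by_contra hx
    obtain ⟨t, ht⟩ := hplane z₀ z₁ hz₀ hz₁ u hu₀ hu₁ x a₂ h0 h1 ha₂0 ha₂1 hx
    exact ha₂2 (ht ▸ Submodule.smul_mem _ t h2)
  have ha₁1 : a₁ ∉ LinearMap.range (J z₁) := fun h => ha₁ (hno _ ha₁0 h ha₁2)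
  have ha₀0 : a₀ ∉ LinearMap.range (J z₀) := fun h => ha₀ (hno _ h ha₀1 ha₀2)
  have hcoef : ∀ (P : Submodule ℝ V) (r : ℝ) (x y : V), x ∉ P → y ∈ P → r • x + y = 0 →
      r = 0 := by
    intro P r x y hx hy h
    by_contra hr
    apply hx
    rw [← inv_smul_smul₀ hr x, eq_neg_of_add_eq_zero_left h]
    exact P.smul_mem _ (P.neg_mem hy)
  have hli : LinearIndependent ℝ ![a₀, a₁, a₂] := by
    rw [Fintype.linearIndependent_iff]
    intro g hg
    simp only [Fin.sum_univ_three, Matrix.cons_val] at hg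
    have h0 : g 0 = 0 := hcoef (LinearMap.range (J z₀)) _ a₀ (g 1 • a₁ + g 2 • a₂) ha₀0
      (add_mem (Submodule.smul_mem _ _ ha₁0) (Submodule.smul_mem _ _ ha₂0)) (by rw [← hg]; abel)
    have h1 : g 1 = 0 := hcoef (LinearMap.range (J z₁)) _ a₁ (g 0 • a₀ + g 2 • a₂) ha₁1
      (add_mem (Submodule.smul_mem _ _ ha₀1) (Submodule.smul_mem _ _ ha₂1)) (by rw [← hg]; abel)
    have h2 : g 2 = 0 := hcoef (LinearMap.range (J z₂)) _ a₂ (g 0 • a₀ + g 1 • a₁) ha₂2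
      (add_mem (Submodule.smul_mem _ _ ha₀2) (Submodule.smul_mem _ _ ha₁2)) (by rw [← hg]; abel)
    intro i
    fin_cases i <;> assumption
  set S := Submodule.span ℝ (Set.range ![a₀, a₁, a₂]) with hS
  have hSmem : ∀ i, ![a₀, a₁, a₂] i ∈ S := fun i => Submodule.subset_span ⟨i, rfl⟩
  have hle_of : ∀ (z : Z), z ≠ 0 → ∀ x y : V, x ∈ LinearMap.range (J z) →
      y ∈ LinearMap.range (J z) → x ∈ S → y ∈ S → x ≠ 0 → (∀ t : ℝ, y ≠ t • x) →
      LinearMap.range (J z) ≤ S := by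
    intro z hz x y hx hy hxS hyS hx0 ht
    by_contra hle
    obtain ⟨t, h⟩ := exists_eq_smul_of_plane_not_le (hrank z hz) hle hx hxS hy hyS hx0
    exact ht t h
  have hle0 : LinearMap.range (J z₀) ≤ S :=
    hle_of z₀ hz₀ a₁ a₂ ha₁0 ha₂0 (hSmem 1) (hSmem 2) ha₁
      fun t h => ha₂2 (h ▸ Submodule.smul_mem _ t ha₁2)
  have hle1 : LinearMap.range (J z₁) ≤ S :=
    hle_of z₁ hz₁ a₀ a₂ ha₀1 ha₂1 (hSmem 0) (hSmem 2) ha₀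
      fun t h => ha₂2 (h ▸ Submodule.smul_mem _ t ha₀2)
  have hle2 : LinearMap.range (J z₂) ≤ S :=
    hle_of z₂ hz₂ a₀ a₁ ha₀2 ha₁2 (hSmem 0) (hSmem 1) ha₀
      fun t h => ha₁1 (h ▸ Submodule.smul_mem _ t ha₀1)
  have hle : ∀ z : Z, LinearMap.range (J z) ≤ S := by
    intro z
    by_cases hz : z = 0
    · simp [hz]
    obtain ⟨x, hx, hxz, hx0⟩ := hE z z₀ hz hz₀
    obtain ⟨y, hy, hyz, hy1⟩ := hE z z₁ hz hz₁
    obtain ⟨w, hw, hwz, hw2⟩ := hE z z₂ hz hz₂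
    by_contra hcon
    obtain ⟨s, hs⟩ := exists_eq_smul_of_plane_not_le (hrank z hz) hcon hyz (hle1 hy1) hxz
      (hle0 hx0) hy
    obtain ⟨t, ht⟩ := exists_eq_smul_of_plane_not_le (hrank z hz) hcon hwz (hle2 hw2) hxz
      (hle0 hx0) hw
    exact hx (hno x hx0 (hs ▸ Submodule.smul_mem _ s hy1) (ht ▸ Submodule.smul_mem _ t hw2))
  have hStop : ⊤ ≤ S := hsup ▸ iSup_le hle
  let b : Basis (Fin 3) ℝ V := Basis.mk hli hStop
  have hV : finrank ℝ V = 3 := by simpa using Module.finrank_eq_card_basis b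
  have hb : ∀ n : V, inner ℝ n a₀ = 0 → inner ℝ n a₁ = 0 → inner ℝ n a₂ = 0 → n = 0 := by
    intro n h0 h1 h2
    refine InnerProductSpace.ext_inner_right_basis b fun j => ?_
    rw [inner_zero_left, Basis.mk_apply]
    fin_cases j <;> assumption
  have hker : ∀ z : Z, z ≠ 0 → ∃ n, n ≠ 0 ∧ J z n = 0 := by
    intro z hz
    have h := LinearMap.finrank_range_add_finrank_ker (J z)
    rw [hrank z hz, hV] at h
    obtain ⟨n, hn, hn0⟩ := Submodule.exists_mem_ne_zero_of_ne_bot (p := LinearMap.ker (J z))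
      (fun hbot => by rw [hbot, finrank_bot] at h; omega)
    exact ⟨n, hn0, hn⟩
  obtain ⟨n₀, hn₀, hJ0⟩ := hker z₀ hz₀
  obtain ⟨n₁, hn₁, hJ1⟩ := hker z₁ hz₁
  obtain ⟨n₂, hn₂, hJ2⟩ := hker z₂ hz₂
  have h01 := inner_eq_zero_of_mem_ker_of_mem_range (hskew z₀) hJ0 ha₁0
  have h02 := inner_eq_zero_of_mem_ker_of_mem_range (hskew z₀) hJ0 ha₂0
  have h10 := inner_eq_zero_of_mem_ker_of_mem_range (hskew z₁) hJ1 ha₀1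
  have h12 := inner_eq_zero_of_mem_ker_of_mem_range (hskew z₁) hJ1 ha₂1
  have h20 := inner_eq_zero_of_mem_ker_of_mem_range (hskew z₂) hJ2 ha₀2
  have h21 := inner_eq_zero_of_mem_ker_of_mem_range (hskew z₂) hJ2 ha₁2
  have h00 : inner ℝ n₀ a₀ ≠ 0 := fun h => hn₀ (hb _ h h01 h02)
  have h11 : inner ℝ n₁ a₁ ≠ 0 := fun h => hn₁ (hb _ h10 h h12)
  have h22 : inner ℝ n₂ a₂ ≠ 0 := fun h => hn₂ (hb _ h20 h21 h)
  have hnli : LinearIndependent ℝ ![n₀, n₁, n₂] := by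
    rw [Fintype.linearIndependent_iff]
    intro g hg
    simp only [Fin.sum_univ_three, Matrix.cons_val] at hg
    have hg' : ∀ a, g 0 * inner ℝ n₀ a + g 1 * inner ℝ n₁ a + g 2 * inner ℝ n₂ a = 0 := by
      intro a
      rw [← real_inner_smul_left, ← real_inner_smul_left, ← real_inner_smul_left,
        ← inner_add_left, ← inner_add_left, hg, inner_zero_left]
    have e0 := hg' a₀
    have e1 := hg' a₁
    have e2 := hg' a₂
    simp only [h10, h20, h01, h21, h02, h12, mul_zero, add_zero, zero_add, mul_eq_zero, h00, h11,
      h22, or_false] at e0 e1 e2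
    intro i
    fin_cases i <;> assumption
  let n : Basis (Fin 3) ℝ V := basisOfLinearIndependentOfCardEqFinrank hnli (by simp [hV])
  have hn0 : n 0 = n₀ := by simp [n]
  have hn1 : n 1 = n₁ := by simp [n]
  have hn2 : n 2 = n₂ := by simp [n]
  have hJ_zero : ∀ z : Z, inner ℝ (J z n₁) n₂ = 0 → inner ℝ (J z n₂) n₀ = 0 →
      inner ℝ (J z n₀) n₁ = 0 → z = 0 := by
    intro z e0 e1 e2
    by_contra hz
    have hJz : J z = 0 := skew_eq_zero_of_basis n (hskew z) (by rwa [hn1, hn2])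
      (by rwa [hn2, hn0]) (by rwa [hn0, hn1])
    have h := hrank z hz
    rw [hJz, LinearMap.range_zero, finrank_bot] at h
    omega
  have hflip : ∀ (z : Z) (x y : V), J z y = 0 → inner ℝ (J z x) y = 0 := by
    intro z x y h
    rw [inner_skew (hskew z), h, inner_zero_right, neg_zero]
  refine ⟨le_antisymm ?_ ?_, hV⟩
  · let ev (x y : V) : Z →ₗ[ℝ] ℝ := (innerₛₗ ℝ y) ∘ₗ (J.flip x)
    have hev : ∀ x y z, ev x y z = inner ℝ (J z x) y := fun x y z => real_inner_comm _ _
    let f : Z →ₗ[ℝ] (Fin 3 → ℝ) := LinearMap.pi ![ev n₁ n₂, ev n₂ n₀, ev n₀ n₁]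
    have hf : Function.Injective f := by
      rw [injective_iff_map_eq_zero]
      intro z hz
      have e0 : ev n₁ n₂ z = 0 := congrFun hz 0
      have e1 : ev n₂ n₀ z = 0 := congrFun hz 1
      have e2 : ev n₀ n₁ z = 0 := congrFun hz 2
      rw [hev] at e0 e1 e2
      exact hJ_zero z e0 e1 e2
    simpa using LinearMap.finrank_le_finrank_of_injective hf
  · have hzli : LinearIndependent ℝ ![z₀, z₁, z₂] := by
      rw [Fintype.linearIndependent_iff]
      intro g hg
      simp only [Fin.sum_univ_three, Matrix.cons_val] at hg
      have hg' : ∀ x y : V, g 0 * inner ℝ (J z₀ x) y + g 1 * inner ℝ (J z₁ x) y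
          + g 2 * inner ℝ (J z₂ x) y = 0 := by
        intro x y
        have h : inner ℝ (J (g 0 • z₀ + g 1 • z₁ + g 2 • z₂) x) y = 0 := by
          rw [hg, map_zero, LinearMap.zero_apply, inner_zero_left]
        simpa only [map_add, map_smul, LinearMap.add_apply, LinearMap.smul_apply, inner_add_left,
          real_inner_smul_left] using h
      have m0 : inner ℝ (J z₀ n₁) n₂ ≠ 0 := fun h =>
        hz₀ (hJ_zero z₀ h (hflip _ _ _ hJ0) (by rw [hJ0, inner_zero_left]))
      have m1 : inner ℝ (J z₁ n₂) n₀ ≠ 0 := fun h =>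
        hz₁ (hJ_zero z₁ (by rw [hJ1, inner_zero_left]) h (hflip _ _ _ hJ1))
      have m2 : inner ℝ (J z₂ n₀) n₁ ≠ 0 := fun h =>
        hz₂ (hJ_zero z₂ (hflip _ _ _ hJ2) (by rw [hJ2, inner_zero_left]) h)
      have e0 := hg' n₁ n₂
      have e1 := hg' n₂ n₀
      have e2 := hg' n₀ n₁
      rw [hJ1, hflip z₂ _ _ hJ2] at e0
      rw [hJ2, hflip z₀ _ _ hJ0] at e1
      rw [hJ0, hflip z₁ _ _ hJ1] at e2
      simp only [inner_zero_left, mul_zero, add_zero, zero_add, mul_eq_zero, m0, m1, m2,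
        or_false] at e0 e1 e2
      intro i
      fin_cases i <;> assumption
    simpa using hzli.fintype_card_le_finrank
end

section
/- Let Z₁, V₁, Z₂, V₂ be finite-dimensional real inner product spaces with Z₁ and Z₂ not both zero, and let J₁ : Z₁ →ₗ[ℝ] End(V₁) and J₂ : Z₂ →ₗ[ℝ] End(V₂) be injective skew-valued linear maps. Equip Z₁ × Z₂ and V₁ × V₂ with the orthogonal direct-sum (ℓ²) inner products and define the linear map J : Z₁ × Z₂ →ₗ[ℝ] End(V₁ × V₂) by J(z₁, z₂) = (J₁ z₁) × (J₂ z₂), acting componentwise. Then J has constant J-spectrum S for some multiset S if and only if either (Z₂ = {0} and J₁ has constant J-spectrum for some multiset) or (Z₁ = {0} and J₂ has constant J-spectrum for some multiset). -/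
open Module

/-- The complex spectrum of an endomorphism of a finite-dimensional real vector
space: the multiset of roots in `ℂ` of its characteristic polynomial. -/
noncomputable def cSpectrum {V : Type*} [AddCommGroup V] [Module ℝ V]
    [FiniteDimensional ℝ V] (f : V →ₗ[ℝ] V) : Multiset ℂ :=
  (f.charpoly.map (algebraMap ℝ ℂ)).roots

/-- The componentwise endomorphism `(f × g)` of the orthogonal (ℓ²) direct sum
`V₁ ⊕ V₂`. -/
noncomputable def pairEnd {V₁ V₂ : Type*}
    [NormedAddCommGroup V₁] [InnerProductSpace ℝ V₁]
    [NormedAddCommGroup V₂] [InnerProductSpace ℝ V₂]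
    (f : V₁ →ₗ[ℝ] V₁) (g : V₂ →ₗ[ℝ] V₂) :
    WithLp 2 (V₁ × V₂) →ₗ[ℝ] WithLp 2 (V₁ × V₂) :=
  (WithLp.linearEquiv 2 ℝ (V₁ × V₂)).symm.toLinearMap ∘ₗ f.prodMap g ∘ₗ
    (WithLp.linearEquiv 2 ℝ (V₁ × V₂)).toLinearMap

/-- The direct-sum `J`-map `(z₁, z₂) ↦ (J₁ z₁) × (J₂ z₂)` on the orthogonal
direct sums `Z₁ ⊕ Z₂` and `V₁ ⊕ V₂`. -/
noncomputable def prodJ {Z₁ Z₂ V₁ V₂ : Type*}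
    [NormedAddCommGroup Z₁] [InnerProductSpace ℝ Z₁]
    [NormedAddCommGroup Z₂] [InnerProductSpace ℝ Z₂]
    [NormedAddCommGroup V₁] [InnerProductSpace ℝ V₁]
    [NormedAddCommGroup V₂] [InnerProductSpace ℝ V₂]
    (J₁ : Z₁ →ₗ[ℝ] (V₁ →ₗ[ℝ] V₁)) (J₂ : Z₂ →ₗ[ℝ] (V₂ →ₗ[ℝ] V₂)) :
    WithLp 2 (Z₁ × Z₂) →ₗ[ℝ] (WithLp 2 (V₁ × V₂) →ₗ[ℝ] WithLp 2 (V₁ × V₂)) :=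
  ((WithLp.linearEquiv 2 ℝ (V₁ × V₂)).symm.conj.toLinearMap) ∘ₗ
    (LinearMap.prodMapLinear ℝ V₁ V₂ V₁ V₂ ℝ) ∘ₗ (J₁.prodMap J₂) ∘ₗ
    (WithLp.linearEquiv 2 ℝ (Z₁ × Z₂)).toLinearMap

theorem cSpectrum_prodJ {Z₁ Z₂ V₁ V₂ : Type*}
    [NormedAddCommGroup Z₁] [InnerProductSpace ℝ Z₁]
    [NormedAddCommGroup Z₂] [InnerProductSpace ℝ Z₂]
    [NormedAddCommGroup V₁] [InnerProductSpace ℝ V₁] [FiniteDimensional ℝ V₁]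
    [NormedAddCommGroup V₂] [InnerProductSpace ℝ V₂] [FiniteDimensional ℝ V₂]
    (J₁ : Z₁ →ₗ[ℝ] (V₁ →ₗ[ℝ] V₁)) (J₂ : Z₂ →ₗ[ℝ] (V₂ →ₗ[ℝ] V₂)) (z : WithLp 2 (Z₁ × Z₂)) :
    cSpectrum (prodJ J₁ J₂ z) = cSpectrum (J₁ z.fst) + cSpectrum (J₂ z.snd) := by
  have h : prodJ J₁ J₂ z = (WithLp.linearEquiv 2 ℝ (V₁ × V₂)).symm.conj
      ((J₁ z.fst).prodMap (J₂ z.snd)) := rfl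
  rw [cSpectrum, h, LinearEquiv.charpoly_conj, LinearMap.charpoly_prodMap, Polynomial.map_mul,
    Polynomial.roots_mul]
  · rfl
  · exact mul_ne_zero (((LinearMap.charpoly_monic _).map _).ne_zero)
      (((LinearMap.charpoly_monic _).map _).ne_zero)

theorem ker_pow_eq_ker_of_adjoint_eq_neg {V : Type*} [NormedAddCommGroup V]
    [InnerProductSpace ℝ V] [FiniteDimensional ℝ V] {f : V →ₗ[ℝ] V}
    (hf : LinearMap.adjoint f = -f) (n : ℕ) :
    LinearMap.ker (f ^ (n + 1)) = LinearMap.ker f := by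
  have hsq : ∀ x, f (f x) = 0 → f x = 0 := fun x hx => by
    have h := LinearMap.adjoint_inner_left f x (f x)
    rw [hf, LinearMap.neg_apply, hx, neg_zero, inner_zero_left] at h
    exact inner_self_eq_zero.mp h.symm
  induction n with
  | zero => simp
  | succ n ih =>
    refine le_antisymm (fun x hx => ?_) (fun x hx => ?_)
    · rw [LinearMap.mem_ker, pow_succ, Module.End.mul_apply, ← LinearMap.mem_ker, ih] at hx
      exact hsq x hx
    · rw [LinearMap.mem_ker] at hx ⊢
      rw [pow_succ, Module.End.mul_apply, hx, map_zero]

theorem count_zero_cSpectrum {V : Type*} [NormedAddCommGroup V]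
    [InnerProductSpace ℝ V] [FiniteDimensional ℝ V] {f : V →ₗ[ℝ] V}
    (hf : LinearMap.adjoint f = -f) :
    (cSpectrum f).count 0 = finrank ℝ (LinearMap.ker f) := by
  have hm : f.charpoly.rootMultiplicity 0 = (cSpectrum f).count 0 := by
    rw [cSpectrum, Polynomial.count_roots,
      Polynomial.eq_rootMultiplicity_map (algebraMap ℝ ℂ).injective, map_zero]
  rw [← hm, ← LinearMap.finrank_maxGenEigenspace_eq]
  suffices h : Module.End.maxGenEigenspace f 0 = LinearMap.ker f by rw [h]
  ext x
  rw [Module.End.mem_maxGenEigenspace]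
  simp only [zero_smul, sub_zero]
  refine ⟨fun ⟨k, hk⟩ => ?_, fun h => ⟨1, by simpa using h⟩⟩
  rw [← ker_pow_eq_ker_of_adjoint_eq_neg hf k, LinearMap.mem_ker, pow_succ',
    Module.End.mul_apply, hk, map_zero]

/-- **Direct sums and constant `J`-spectrum.**  The orthogonal direct sum of two
metric nilpotent Lie algebras (encoded by injective skew-valued `J`-maps) has
constant `J`-spectrum iff one of the summands is abelian (its commutator is
zero) and the other has constant `J`-spectrum. -/
theorem stmt4 {Z₁ Z₂ V₁ V₂ : Type*}
    [NormedAddCommGroup Z₁] [InnerProductSpace ℝ Z₁] [FiniteDimensional ℝ Z₁]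
    [NormedAddCommGroup Z₂] [InnerProductSpace ℝ Z₂] [FiniteDimensional ℝ Z₂]
    [NormedAddCommGroup V₁] [InnerProductSpace ℝ V₁] [FiniteDimensional ℝ V₁]
    [NormedAddCommGroup V₂] [InnerProductSpace ℝ V₂] [FiniteDimensional ℝ V₂]
    (J₁ : Z₁ →ₗ[ℝ] (V₁ →ₗ[ℝ] V₁)) (J₂ : Z₂ →ₗ[ℝ] (V₂ →ₗ[ℝ] V₂))
    (hinj₁ : Function.Injective J₁) (hinj₂ : Function.Injective J₂)
    (hskew₁ : ∀ z : Z₁, LinearMap.adjoint (J₁ z) = -(J₁ z))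
    (hskew₂ : ∀ z : Z₂, LinearMap.adjoint (J₂ z) = -(J₂ z))
    (hnz : (∃ z : Z₁, z ≠ 0) ∨ (∃ z : Z₂, z ≠ 0)) :
    (∃ S : Multiset ℂ, ∀ z : WithLp 2 (Z₁ × Z₂), ‖z‖ = 1 →
        cSpectrum (prodJ J₁ J₂ z) = S) ↔
      ((∀ z : Z₂, z = 0) ∧
        ∃ S₁ : Multiset ℂ, ∀ z₁ : Z₁, ‖z₁‖ = 1 → cSpectrum (J₁ z₁) = S₁) ∨
      ((∀ z : Z₁, z = 0) ∧
        ∃ S₂ : Multiset ℂ, ∀ z₂ : Z₂, ‖z₂‖ = 1 → cSpectrum (J₂ z₂) = S₂) := by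
  simp only [cSpectrum_prodJ]
  have hnorm (a : Z₁) (b : Z₂) (h : ‖a‖ ^ 2 + ‖b‖ ^ 2 = 1) :
      ‖WithLp.toLp 2 (a, b)‖ = 1 := by
    rw [← sq_eq_sq₀ (norm_nonneg _) zero_le_one, WithLp.prod_norm_sq_eq_of_L2]
    simpa using h
  constructor
  · rintro ⟨S, hS⟩
    by_cases h₂ : ∀ z : Z₂, z = 0
    · refine Or.inl ⟨h₂, S - cSpectrum (J₂ 0), fun z hz => ?_⟩
      rw [← hS (WithLp.toLp 2 (z, 0)) (hnorm z 0 (by simp [hz]))]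
      simp
    by_cases h₁ : ∀ z : Z₁, z = 0
    · refine Or.inr ⟨h₁, S - cSpectrum (J₁ 0), fun z hz => ?_⟩
      rw [← hS (WithLp.toLp 2 (0, z)) (hnorm 0 z (by simp [hz]))]
      simp
    push Not at h₁ h₂
    obtain ⟨a, ha⟩ := h₁
    obtain ⟨b, hb⟩ := h₂
    have hna : ‖a‖ ≠ 0 := norm_ne_zero_iff.mpr ha
    have hnb : ‖b‖ ≠ 0 := norm_ne_zero_iff.mpr hb
    have key := congrArg (Multiset.count 0) <|
      (hS (WithLp.toLp 2 ((‖a‖⁻¹ : ℝ) • a, 0)) (hnorm _ _ (by simp [norm_smul, hna]))).trans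
      (hS (WithLp.toLp 2 ((3 / 5 * ‖a‖⁻¹ : ℝ) • a, (4 / 5 * ‖b‖⁻¹ : ℝ) • b)) (hnorm _ _ (by
        simp only [norm_smul, norm_mul, norm_inv, norm_norm, mul_assoc, inv_mul_cancel₀ hna,
          inv_mul_cancel₀ hnb]
        norm_num))).symm
    simp only [Multiset.count_add, count_zero_cSpectrum (hskew₁ _),
      count_zero_cSpectrum (hskew₂ _)] at key
    rw [WithLp.toLp_fst, WithLp.toLp_fst, WithLp.toLp_snd, WithLp.toLp_snd, map_smul, map_smul,
      map_smul, map_zero, LinearMap.ker_smul _ _ (by positivity),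
      LinearMap.ker_smul _ _ (by positivity), LinearMap.ker_smul _ _ (by positivity),
      LinearMap.ker_zero, finrank_top, add_right_inj] at key
    have hB := LinearMap.ker_eq_top.mp (Submodule.eq_top_of_finrank_eq key.symm)
    exact absurd (hinj₂ (hB.trans (map_zero J₂).symm)) hb
  · rintro (⟨h₂, S, hS⟩ | ⟨h₁, S, hS⟩)
    · refine ⟨S + cSpectrum (J₂ 0), fun z hz => ?_⟩
      have h := WithLp.prod_norm_sq_eq_of_L2 z
      rw [h₂ z.snd, hz, norm_zero] at h
      rw [h₂ z.snd, hS z.fst ((sq_eq_sq₀ (norm_nonneg _) zero_le_one).mp (by linarith))]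
    · refine ⟨cSpectrum (J₁ 0) + S, fun z hz => ?_⟩
      have h := WithLp.prod_norm_sq_eq_of_L2 z
      rw [h₁ z.fst, hz, norm_zero] at h
      rw [h₁ z.fst, hS z.snd ((sq_eq_sq₀ (norm_nonneg _) zero_le_one).mp (by linarith))]
end

section
/- Let k ≥ 1 and p ≥ 1. For each i ∈ Fin k, let V_i be a finite-dimensional real inner product space of dimension at least 2, let S_i be an admissible multiset of size dim V_i, and let A_i^1, …, A_i^p be skew-adjoint endomorphisms of V_i such that: (a) for each j, the complex spectrum of A_i^j equals S_i; (b) for all real c₁, …, c_p there exists r ≥ 0 such that the complex spectrum of Σ_j c_j • A_i^j equals r • S_i (i.e., the span of {A_i^j : j} lies in the cone ℝC_{S_i}); and (c) trace(A_i^j ∘ (A_i^{j'})†) = 0 whenever j ≠ j'. Let V be the ℓ² direct sum of the V_i and for each j define B_j ∈ End(V) by (B_j x)_i = A_i^j(x_i). Then for all real c₁, …, c_p the complex spectrum of Σ_j c_j • B_j equals sqrt(Σ_j c_j²) • S, where S = S_1 + ⋯ + S_k is the multiset sum; in particular the span of {B_j : j} lies in the cone ℝC_S. -/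
open Module

-- A multiset of complex numbers is admissible if all its elements are purely
-- imaginary and `ib`, `-ib` have equal multiplicities for every real `b > 0`.
open scoped Classical in
def IsAdmissible (S : Multiset ℂ) : Prop :=
  (∀ a ∈ S, a.re = 0) ∧
  ∀ b : ℝ, 0 < b → S.count (Complex.I * b) = S.count (-(Complex.I * b))

/-- The block-diagonal endomorphism of the ℓ² direct sum `⨁ᵢ Vᵢ` acting as
`A i j` on the `i`-th summand. -/
noncomputable def blockEnd {k p : ℕ} {V : Fin k → Type*}
    [∀ i, NormedAddCommGroup (V i)] [∀ i, InnerProductSpace ℝ (V i)]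
    (A : ∀ i, Fin p → (V i →ₗ[ℝ] V i)) (j : Fin p) :
    PiLp 2 V →ₗ[ℝ] PiLp 2 V :=
  (WithLp.linearEquiv 2 ℝ (∀ i, V i)).symm.toLinearMap ∘ₗ
    (LinearMap.pi (fun i => (A i j) ∘ₗ LinearMap.proj i)) ∘ₗ
    (WithLp.linearEquiv 2 ℝ (∀ i, V i)).toLinearMap

/-- The squares of the eigenvalues of a complex matrix, with multiplicity, are the eigenvalues of
its square. -/
theorem Matrix.charpoly_mul_self {n : Type*} [Fintype n] [DecidableEq n] (M : Matrix n n ℂ) :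
    (M * M).charpoly = ((M.charpoly.roots.map (fun a => a ^ 2)).map
      (fun a => Polynomial.X - Polynomial.C a)).prod := by
  have hroots (t : ℂ) : M.charpoly.eval t = (M.charpoly.roots.map (fun a => t - a)).prod := by
    conv_lhs => rw [(IsAlgClosed.splits M.charpoly).eq_prod_roots_of_monic M.charpoly_monic]
    simp [Polynomial.eval_multiset_prod, Multiset.map_map]
  have hcard : Multiset.card M.charpoly.roots = Fintype.card n := by
    rw [← (IsAlgClosed.splits M.charpoly).natDegree_eq_card_roots, M.charpoly_natDegree_eq_dim]
  refine Polynomial.funext fun z => ?_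
  obtain ⟨t, rfl⟩ := IsAlgClosed.exists_eq_mul_self z
  have hfactor : Matrix.scalar n (t * t) - M * M =
      (Matrix.scalar n t - M) * -(Matrix.scalar n (-t) - M) := by
    have hcomm : Matrix.scalar n t * M = M * Matrix.scalar n t :=
      (Matrix.scalar_commute t (fun _ => mul_comm _ _) M).eq
    simp only [map_neg, map_mul]
    rw [neg_sub, sub_neg_eq_add, sub_mul, mul_add, mul_add, hcomm]
    abel
  rw [Matrix.eval_charpoly, hfactor, Matrix.det_mul, Matrix.det_neg, ← Matrix.eval_charpoly,
    ← Matrix.eval_charpoly, hroots, hroots, ← hcard]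
  simp only [Polynomial.eval_multiset_prod, Multiset.map_map, Function.comp_def,
    Polynomial.eval_sub, Polynomial.eval_X, Polynomial.eval_C]
  rw [← Multiset.prod_replicate, ← Multiset.map_const', ← Multiset.prod_map_mul,
    ← Multiset.prod_map_mul]
  refine congrArg Multiset.prod (Multiset.map_congr rfl fun a _ => ?_)
  ring

theorem trace_comp_self_eq_sum_sq {V : Type*} [AddCommGroup V] [Module ℝ V]
    [FiniteDimensional ℝ V] (f : V →ₗ[ℝ] V) :
    ((LinearMap.trace ℝ V (f ∘ₗ f) : ℝ) : ℂ) = ((cSpectrum f).map (fun a => a ^ 2)).sum := by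
  let b := Module.finBasis ℝ V
  let M : Matrix (Fin (finrank ℝ V)) (Fin (finrank ℝ V)) ℂ :=
    (LinearMap.toMatrix b b f).map (algebraMap ℝ ℂ)
  have hM : cSpectrum f = M.charpoly.roots := by
    rw [cSpectrum, ← LinearMap.charpoly_toMatrix f b, ← Matrix.charpoly_map]
  have htrace : ((LinearMap.trace ℝ V (f ∘ₗ f) : ℝ) : ℂ) = (M * M).trace := by
    rw [LinearMap.trace_eq_matrix_trace ℝ b, LinearMap.toMatrix_comp b b b, ← Matrix.map_mul]
    exact AddMonoidHom.map_trace (algebraMap ℝ ℂ)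
      (LinearMap.toMatrix b b f * LinearMap.toMatrix b b f)
  rw [htrace, Matrix.trace_eq_sum_roots_charpoly, Matrix.charpoly_mul_self,
    Polynomial.roots_multiset_prod_X_sub_C, hM]

theorem Matrix.charpoly_blockDiagonal' {o R : Type*} [Fintype o] [LinearOrder o] [CommRing R]
    {m : o → Type*} [∀ i, Fintype (m i)] [∀ i, DecidableEq (m i)]
    (M : ∀ i, Matrix (m i) (m i) R) :
    (Matrix.blockDiagonal' M).charpoly = ∏ i, (M i).charpoly := by
  unfold Matrix.charpoly
  rw [(Matrix.blockTriangular_blockDiagonal' M).charmatrix.det_fintype]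
  refine Finset.prod_congr rfl fun i _ => ?_
  rw [← Matrix.charmatrix_toSquareBlock, ← Matrix.charpoly, ← Matrix.charpoly,
    ← Matrix.charpoly_reindex (Equiv.sigmaSubtype i).symm (M i)]
  congr 1
  ext x y
  obtain ⟨x, rfl⟩ := (Equiv.sigmaSubtype i).symm.surjective x
  obtain ⟨y, rfl⟩ := (Equiv.sigmaSubtype i).symm.surjective y
  simp [Matrix.toSquareBlock_def, Equiv.sigmaSubtype]

theorem LinearMap.charpoly_pi_comp_proj {ι R : Type*} [Fintype ι] [LinearOrder ι] [CommRing R]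
    {V : ι → Type*} [∀ i, AddCommGroup (V i)] [∀ i, Module R (V i)]
    [∀ i, Module.Free R (V i)] [∀ i, Module.Finite R (V i)] (f : ∀ i, V i →ₗ[R] V i) :
    (LinearMap.pi fun i => f i ∘ₗ LinearMap.proj i).charpoly = ∏ i, (f i).charpoly := by
  let b := fun i => Module.Free.chooseBasis R (V i)
  have h : LinearMap.toMatrix (Pi.basis b) (Pi.basis b)
      (LinearMap.pi fun i => f i ∘ₗ LinearMap.proj i) =
      Matrix.blockDiagonal' fun i => LinearMap.toMatrix (b i) (b i) (f i) := by
    ext ⟨i, x⟩ ⟨j, y⟩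
    rw [Matrix.blockDiagonal'_apply]
    simp only [LinearMap.toMatrix_apply, Pi.basis_repr, Pi.basis_apply, LinearMap.pi_apply,
      LinearMap.comp_apply, LinearMap.proj_apply]
    split_ifs with hij
    · subst hij
      simp
    · simp [Pi.single_eq_of_ne hij]
  rw [← LinearMap.charpoly_toMatrix _ (Pi.basis b), h, Matrix.charpoly_blockDiagonal']
  simp only [LinearMap.charpoly_toMatrix]

theorem sum_smul_blockEnd {k p : ℕ} {V : Fin k → Type*}
    [∀ i, NormedAddCommGroup (V i)] [∀ i, InnerProductSpace ℝ (V i)]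
    (A : ∀ i, Fin p → (V i →ₗ[ℝ] V i)) (c : Fin p → ℝ) :
    ∑ j, c j • blockEnd A j = (WithLp.linearEquiv 2 ℝ (∀ i, V i)).symm.conj
      (LinearMap.pi fun i => (∑ j, c j • A i j) ∘ₗ LinearMap.proj i) := by
  ext x i
  simp [blockEnd, LinearEquiv.conj_apply, LinearMap.sum_apply]

theorem cSpectrum_sum_smul_blockEnd {k p : ℕ} {V : Fin k → Type*}
    [∀ i, NormedAddCommGroup (V i)] [∀ i, InnerProductSpace ℝ (V i)]
    [∀ i, FiniteDimensional ℝ (V i)]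
    (A : ∀ i, Fin p → (V i →ₗ[ℝ] V i)) (c : Fin p → ℝ) :
    cSpectrum (∑ j, c j • blockEnd A j) = ∑ i, cSpectrum (∑ j, c j • A i j) := by
  unfold cSpectrum
  rw [sum_smul_blockEnd, LinearEquiv.charpoly_conj, LinearMap.charpoly_pi_comp_proj,
    Polynomial.map_prod, Polynomial.roots_prod]
  · rfl
  · exact Finset.prod_ne_zero_iff.2 fun i _ => ((LinearMap.charpoly_monic _).map _).ne_zero

/-- If skew-adjoint endomorphisms with common spectrum `S` are pairwise orthogonal and their span
lies in the cone over `S`, the scaling factor of a linear combination is the Euclidean norm of its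
coefficients. -/
theorem cSpectrum_sum_smul_of_cone {p : ℕ} {V : Type*} [NormedAddCommGroup V]
    [InnerProductSpace ℝ V] [FiniteDimensional ℝ V] {S : Multiset ℂ}
    (hS : ∀ a ∈ S, a.re = 0) (A : Fin p → (V →ₗ[ℝ] V))
    (hskew : ∀ j, LinearMap.adjoint (A j) = -(A j))
    (hspec : ∀ j, cSpectrum (A j) = S)
    (horth : ∀ j j' : Fin p, j ≠ j' →
      LinearMap.trace ℝ V ((A j) ∘ₗ LinearMap.adjoint (A j')) = 0)
    (c : Fin p → ℝ) {r : ℝ} (hr : 0 ≤ r)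
    (hcone : cSpectrum (∑ j, c j • A j) = S.map (fun a => (r : ℂ) * a)) :
    cSpectrum (∑ j, c j • A j) =
      S.map (fun a => ((Real.sqrt (∑ j, (c j) ^ 2) : ℝ) : ℂ) * a) := by
  set s : ℂ := (S.map (fun a => a ^ 2)).sum with hs
  have hcross (j j' : Fin p) (h : j' ≠ j) : LinearMap.trace ℝ V (A j ∘ₗ A j') = 0 := by
    simpa [hskew] using horth j j' h.symm
  have htrace : LinearMap.trace ℝ V ((∑ j, c j • A j) ∘ₗ (∑ j, c j • A j)) =
      ∑ j, c j ^ 2 * LinearMap.trace ℝ V (A j ∘ₗ A j) := by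
    simp only [← Module.End.mul_eq_comp, Finset.sum_mul, Finset.mul_sum, map_sum]
    rw [Finset.sum_comm]
    refine Finset.sum_congr rfl fun j _ => ?_
    rw [Finset.sum_eq_single j]
    · simp [Module.End.mul_eq_comp]
      ring
    · intro j' _ h
      simp [Module.End.mul_eq_comp, hcross _ _ h]
    · simp
  have key : (r : ℂ) ^ 2 * s = ((∑ j, c j ^ 2 : ℝ) : ℂ) * s := by
    have h := trace_comp_self_eq_sum_sq (∑ j, c j • A j)
    rw [hcone, htrace, Multiset.map_map] at h
    simp only [Function.comp_def, mul_pow, Multiset.sum_map_mul_left] at h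
    rw [← hs] at h
    rw [← h]
    push_cast
    rw [Finset.sum_mul]
    refine Finset.sum_congr rfl fun j _ => ?_
    rw [trace_comp_self_eq_sum_sq, hspec]
  rw [hcone]
  by_cases h0 : s = 0
  · have hzero : ∀ a ∈ S, a = 0 := by
      have him : (S.map (fun a => a.im ^ 2)).sum = 0 := by
        have h : S.map (fun a => a ^ 2) = (S.map (fun a => a.im ^ 2)).map
            (fun x : ℝ => -(x : ℂ)) := by
          rw [Multiset.map_map]
          refine Multiset.map_congr rfl fun a ha => ?_
          apply Complex.ext <;> simp [pow_two, hS a ha]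
        rw [hs, h, Multiset.sum_map_neg] at h0
        have h1 := neg_eq_zero.1 h0
        rw [← Complex.ofReal_eq_zero, ← h1]
        exact map_multiset_sum Complex.ofRealHom _
      intro a ha
      refine Complex.ext (hS a ha) ?_
      have h2 : a.im ^ 2 ≤ (S.map (fun a => a.im ^ 2)).sum :=
        Multiset.single_le_sum (by
          intro x hx
          obtain ⟨y, _, rfl⟩ := Multiset.mem_map.1 hx
          positivity) _ (Multiset.mem_map_of_mem _ ha)
      rw [him] at h2
      exact pow_eq_zero_iff two_ne_zero |>.1 (le_antisymm h2 (sq_nonneg _))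
    exact Multiset.map_congr rfl fun a ha => by simp [hzero a ha]
  · have h1 : r ^ 2 = ∑ j, c j ^ 2 := by exact_mod_cast mul_right_cancel₀ h0 key
    rw [← h1, Real.sqrt_sq hr]

/-- **Block-diagonal subspaces of cones over conjugacy classes.**  Given, for
each `i`, skew-adjoint endomorphisms `A i 1, …, A i p` of `V i`, each with
spectrum the admissible multiset `S i`, whose span lies in the cone `ℝC_{S i}`,
and which are pairwise orthogonal for the Frobenius inner product, every linear
combination `Σ_j c_j • B_j` of the block-diagonal endomorphisms
`B_j = ⊕ᵢ A i j` of `⨁ᵢ Vᵢ` has spectrum `sqrt (Σ_j c_j²) • (S 1 + ⋯ + S k)`;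
in particular the span of the `B_j` lies in the cone `ℝC_{S 1 + ⋯ + S k}`. -/
theorem stmt8 {k p : ℕ} (hk : 1 ≤ k) (hp : 1 ≤ p) {V : Fin k → Type*}
    [∀ i, NormedAddCommGroup (V i)] [∀ i, InnerProductSpace ℝ (V i)]
    [∀ i, FiniteDimensional ℝ (V i)]
    (hdim : ∀ i, 2 ≤ finrank ℝ (V i))
    (S : Fin k → Multiset ℂ)
    (hSadm : ∀ i, IsAdmissible (S i))
    (hScard : ∀ i, Multiset.card (S i) = finrank ℝ (V i))
    (A : ∀ i, Fin p → (V i →ₗ[ℝ] V i))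
    (hskew : ∀ i j, LinearMap.adjoint (A i j) = -(A i j))
    (hspec : ∀ i j, cSpectrum (A i j) = S i)
    (hcone : ∀ (i) (c : Fin p → ℝ), ∃ r : ℝ, 0 ≤ r ∧
      cSpectrum (∑ j, c j • A i j) = (S i).map (fun a => (r : ℂ) * a))
    (horth : ∀ i, ∀ j j' : Fin p, j ≠ j' →
      LinearMap.trace ℝ (V i) ((A i j) ∘ₗ LinearMap.adjoint (A i j')) = 0) :
    ∀ c : Fin p → ℝ,
      cSpectrum (∑ j, c j • blockEnd A j) =
        (∑ i, S i).map (fun a => ((Real.sqrt (∑ j, (c j) ^ 2) : ℝ) : ℂ) * a) := by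
  intro c
  rw [cSpectrum_sum_smul_blockEnd]
  have h (i : Fin k) : cSpectrum (∑ j, c j • A i j) =
      (S i).map (fun a => ((Real.sqrt (∑ j, (c j) ^ 2) : ℝ) : ℂ) * a) := by
    obtain ⟨r, hr, hrc⟩ := hcone i c
    exact cSpectrum_sum_smul_of_cone (hSadm i).1 (A i) (hskew i) (hspec i) (horth i) c hr hrc
  simp only [h]
  exact (map_sum (Multiset.mapAddMonoidHom _) _ _).symm
end

section
/- Let Z, Z', V₁, V₂ be finite-dimensional real inner product spaces, let J₁ : Z →ₗ[ℝ] End(V₁) be skew-valued with constant J-spectrum S₁, let J₂ : Z' →ₗ[ℝ] End(V₂) be skew-valued with constant J-spectrum S₂, and let φ : Z ≃ Z' be a linear isometric equivalence. Equip V₁ × V₂ with the orthogonal direct-sum (ℓ²) inner product. Then the linear map z ↦ (J₁ z) × (J₂(φ z)), acting componentwise on V₁ × V₂, is skew-valued and has constant J-spectrum S₁ + S₂, the multiset sum. (This map is the J-map of the metric central sum of the two associated metric nilpotent Lie algebras.) -/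
open Module

/-- The `J`-map of the metric central sum: `z ↦ (J₁ z) × (J₂ (φ z))` acting
componentwise on the orthogonal (ℓ²) direct sum `V₁ ⊕ V₂`. -/
noncomputable def centralSumJ {Z Z' V₁ V₂ : Type*}
    [NormedAddCommGroup Z] [InnerProductSpace ℝ Z]
    [NormedAddCommGroup Z'] [InnerProductSpace ℝ Z']
    [NormedAddCommGroup V₁] [InnerProductSpace ℝ V₁]
    [NormedAddCommGroup V₂] [InnerProductSpace ℝ V₂]
    (J₁ : Z →ₗ[ℝ] (V₁ →ₗ[ℝ] V₁)) (J₂ : Z' →ₗ[ℝ] (V₂ →ₗ[ℝ] V₂))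
    (φ : Z ≃ₗᵢ[ℝ] Z') :
    Z →ₗ[ℝ] (WithLp 2 (V₁ × V₂) →ₗ[ℝ] WithLp 2 (V₁ × V₂)) :=
  ((WithLp.linearEquiv 2 ℝ (V₁ × V₂)).symm.conj.toLinearMap) ∘ₗ
    (LinearMap.prodMapLinear ℝ V₁ V₂ V₁ V₂ ℝ) ∘ₗ
    (J₁.prod (J₂ ∘ₗ (φ.toLinearEquiv.toLinearMap)))

/-- The complex spectrum is invariant under conjugation by a linear equivalence. -/
theorem cSpectrum_conj {V W : Type*} [AddCommGroup V] [Module ℝ V] [FiniteDimensional ℝ V]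
    [AddCommGroup W] [Module ℝ W] [FiniteDimensional ℝ W] (e : V ≃ₗ[ℝ] W) (f : V →ₗ[ℝ] V) :
    cSpectrum (e.conj f) = cSpectrum f := by
  rw [cSpectrum, cSpectrum, LinearEquiv.charpoly_conj]

/-- The complex spectrum of a direct sum of endomorphisms is the sum of the spectra. -/
theorem cSpectrum_prodMap {V W : Type*} [AddCommGroup V] [Module ℝ V] [FiniteDimensional ℝ V]
    [AddCommGroup W] [Module ℝ W] [FiniteDimensional ℝ W] (f : V →ₗ[ℝ] V) (g : W →ₗ[ℝ] W) :
    cSpectrum (f.prodMap g) = cSpectrum f + cSpectrum g := by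
  rw [cSpectrum, LinearMap.charpoly_prodMap, Polynomial.map_mul, Polynomial.roots_mul]
  · rfl
  · exact mul_ne_zero (f.charpoly_monic.map _).ne_zero (g.charpoly_monic.map _).ne_zero

/-- The adjoint of a direct sum of endomorphisms of the `ℓ²` product is the direct sum of the
adjoints. -/
theorem adjoint_conj_prodMap {V W : Type*}
    [NormedAddCommGroup V] [InnerProductSpace ℝ V] [FiniteDimensional ℝ V]
    [NormedAddCommGroup W] [InnerProductSpace ℝ W] [FiniteDimensional ℝ W]
    (f : V →ₗ[ℝ] V) (g : W →ₗ[ℝ] W) :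
    LinearMap.adjoint ((WithLp.linearEquiv 2 ℝ (V × W)).symm.conj (f.prodMap g)) =
      (WithLp.linearEquiv 2 ℝ (V × W)).symm.conj
        ((LinearMap.adjoint f).prodMap (LinearMap.adjoint g)) := by
  symm
  rw [LinearMap.eq_adjoint_iff]
  intro x y
  simp [LinearEquiv.conj_apply, WithLp.prod_inner_apply, LinearMap.adjoint_inner_left]

theorem centralSumJ_apply {Z Z' V₁ V₂ : Type*}
    [NormedAddCommGroup Z] [InnerProductSpace ℝ Z]
    [NormedAddCommGroup Z'] [InnerProductSpace ℝ Z']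
    [NormedAddCommGroup V₁] [InnerProductSpace ℝ V₁]
    [NormedAddCommGroup V₂] [InnerProductSpace ℝ V₂]
    (J₁ : Z →ₗ[ℝ] (V₁ →ₗ[ℝ] V₁)) (J₂ : Z' →ₗ[ℝ] (V₂ →ₗ[ℝ] V₂))
    (φ : Z ≃ₗᵢ[ℝ] Z') (z : Z) :
    centralSumJ J₁ J₂ φ z =
      (WithLp.linearEquiv 2 ℝ (V₁ × V₂)).symm.conj ((J₁ z).prodMap (J₂ (φ z))) :=
  rfl

/-- **Central sums preserve constant `J`-spectrum.**  If `J₁` is skew-valued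
with constant `J`-spectrum `S₁`, `J₂` is skew-valued with constant `J`-spectrum
`S₂`, and `φ : Z ≃ Z'` is a linear isometric equivalence, then the `J`-map
`z ↦ (J₁ z) × (J₂ (φ z))` of the metric central sum is skew-valued with constant
`J`-spectrum `S₁ + S₂` (the multiset sum). -/
theorem stmt10 {Z Z' V₁ V₂ : Type*}
    [NormedAddCommGroup Z] [InnerProductSpace ℝ Z] [FiniteDimensional ℝ Z]
    [NormedAddCommGroup Z'] [InnerProductSpace ℝ Z'] [FiniteDimensional ℝ Z']
    [NormedAddCommGroup V₁] [InnerProductSpace ℝ V₁] [FiniteDimensional ℝ V₁]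
    [NormedAddCommGroup V₂] [InnerProductSpace ℝ V₂] [FiniteDimensional ℝ V₂]
    (J₁ : Z →ₗ[ℝ] (V₁ →ₗ[ℝ] V₁)) (J₂ : Z' →ₗ[ℝ] (V₂ →ₗ[ℝ] V₂))
    (S₁ S₂ : Multiset ℂ)
    (hskew₁ : ∀ z : Z, LinearMap.adjoint (J₁ z) = -(J₁ z))
    (hskew₂ : ∀ z : Z', LinearMap.adjoint (J₂ z) = -(J₂ z))
    (hconst₁ : ∀ z : Z, ‖z‖ = 1 → cSpectrum (J₁ z) = S₁)
    (hconst₂ : ∀ z : Z', ‖z‖ = 1 → cSpectrum (J₂ z) = S₂)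
    (φ : Z ≃ₗᵢ[ℝ] Z') :
    (∀ z : Z, LinearMap.adjoint (centralSumJ J₁ J₂ φ z) = -(centralSumJ J₁ J₂ φ z)) ∧
    (∀ z : Z, ‖z‖ = 1 → cSpectrum (centralSumJ J₁ J₂ φ z) = S₁ + S₂) := by
  refine ⟨fun z => ?_, fun z hz => ?_⟩
  · rw [centralSumJ_apply, adjoint_conj_prodMap, hskew₁, hskew₂,
      ← map_neg (WithLp.linearEquiv 2 ℝ (V₁ × V₂)).symm.conj]
    rfl
  · rw [centralSumJ_apply, cSpectrum_conj, cSpectrum_prodMap, hconst₁ z hz,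
      hconst₂ (φ z) (by rw [φ.norm_map, hz])]
end

section
/- Assume the rank-two H-like setup. If z₁, z₂ ∈ Z are linearly independent, then E(z₁) ≠ E(z₂) and the submodule E(z₁) ⊓ E(z₂) is one-dimensional. -/
open Module

/-- The range of a skew-adjoint endomorphism is the orthogonal complement of its kernel. -/
lemma orthogonal_ker_of_skew {V : Type*} [NormedAddCommGroup V] [InnerProductSpace ℝ V]
    [FiniteDimensional ℝ V] {A : V →ₗ[ℝ] V} (hA : LinearMap.adjoint A = -A) :
    (LinearMap.ker A)ᗮ = LinearMap.range A := by
  have hinner (x y : V) : inner ℝ (A x) y = -inner ℝ x (A y) := by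
    rw [← LinearMap.adjoint_inner_right, hA, LinearMap.neg_apply, inner_neg_right]
  have h : (LinearMap.range A)ᗮ = LinearMap.ker A := by
    ext x
    rw [Submodule.mem_orthogonal, LinearMap.mem_ker]
    constructor
    · intro hx
      have hAx := hx (A (A x)) ⟨_, rfl⟩
      rw [hinner, neg_eq_zero] at hAx
      exact inner_self_eq_zero.mp hAx
    · rintro hx _ ⟨y, rfl⟩
      rw [hinner, hx, inner_zero_right, neg_zero]
  rw [← h, Submodule.orthogonal_orthogonal]

lemma inner_apply_self_of_skew {V : Type*} [NormedAddCommGroup V] [InnerProductSpace ℝ V]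
    [FiniteDimensional ℝ V] {A : V →ₗ[ℝ] V} (hA : LinearMap.adjoint A = -A) (x : V) :
    inner ℝ (A x) x = 0 := by
  have h := LinearMap.adjoint_inner_right A x x
  rw [hA, LinearMap.neg_apply, inner_neg_right, real_inner_comm] at h
  linarith

/-- If two skew-adjoint endomorphisms have independent ranges, the range of their sum contains
the sum of their ranges. -/
lemma range_sup_le_range_add_of_skew {V : Type*} [NormedAddCommGroup V] [InnerProductSpace ℝ V]
    [FiniteDimensional ℝ V] {A B : V →ₗ[ℝ] V} (hA : LinearMap.adjoint A = -A)
    (hB : LinearMap.adjoint B = -B) (h : LinearMap.range A ⊓ LinearMap.range B = ⊥) :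
    LinearMap.range A ⊔ LinearMap.range B ≤ LinearMap.range (A + B) := by
  have htop : LinearMap.ker A ⊔ LinearMap.ker B = ⊤ := by
    rw [← Submodule.orthogonal_eq_bot_iff, ← Submodule.inf_orthogonal,
      orthogonal_ker_of_skew hA, orthogonal_ker_of_skew hB, h]
  have hsplit (v : V) : ∃ a b : V, A a = 0 ∧ B b = 0 ∧ a + b = v := by
    obtain ⟨a, ha, b, hb, hab⟩ := Submodule.mem_sup.mp (htop ▸ Submodule.mem_top : v ∈ _)
    exact ⟨a, b, ha, hb, hab⟩
  refine sup_le ?_ ?_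
  · rintro _ ⟨v, rfl⟩
    obtain ⟨a, b, ha, hb, rfl⟩ := hsplit v
    exact ⟨b, by simp [ha, hb]⟩
  · rintro _ ⟨v, rfl⟩
    obtain ⟨a, b, ha, hb, rfl⟩ := hsplit v
    exact ⟨a, by simp [ha, hb]⟩

/-- Two skew-adjoint endomorphisms with the same two-dimensional range have a nontrivial linear
combination of a different range. -/
lemma exists_range_smul_add_smul_ne_of_skew {V : Type*} [NormedAddCommGroup V]
    [InnerProductSpace ℝ V] [FiniteDimensional ℝ V] {A B : V →ₗ[ℝ] V}
    (hA : LinearMap.adjoint A = -A) (hB : LinearMap.adjoint B = -B)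
    (hAB : LinearMap.range A = LinearMap.range B) (h2 : finrank ℝ (LinearMap.range A) = 2) :
    ∃ a b : ℝ, ¬(a = 0 ∧ b = 0) ∧
      LinearMap.range (a • A + b • B) ≠ LinearMap.range A := by
  have hne : LinearMap.range A ≠ ⊥ := by
    intro h
    rw [h, finrank_bot] at h2
    omega
  obtain ⟨e, he, he0⟩ := Submodule.exists_mem_ne_zero_of_ne_bot hne
  have hdep : ¬LinearIndependent ℝ
      (![⟨A e, e, rfl⟩, ⟨B e, hAB ▸ ⟨e, rfl⟩⟩, ⟨e, he⟩] : Fin 3 → LinearMap.range A) := by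
    intro hli
    have hcard := hli.fintype_card_le_finrank
    rw [h2, Fintype.card_fin] at hcard
    omega
  obtain ⟨g, hg, i, hi⟩ := Fintype.not_linearIndependent_iff.mp hdep
  have hsum : g 0 • A e + g 1 • B e + g 2 • e = 0 := by
    simpa [Fin.sum_univ_three] using congrArg Subtype.val hg
  have hg2 : g 2 = 0 := by
    have hin : inner ℝ (g 0 • A e + g 1 • B e + g 2 • e) e = 0 := by
      rw [hsum, inner_zero_left]
    simpa [inner_add_left, inner_smul_left, inner_apply_self_of_skew hA,
      inner_apply_self_of_skew hB, he0] using hin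
  refine ⟨g 0, g 1, ?_, ?_⟩
  · rintro ⟨h0, h1⟩
    fin_cases i <;> simp_all
  · intro hrange
    have hskew : LinearMap.adjoint (g 0 • A + g 1 • B) = -(g 0 • A + g 1 • B) := by
      simp only [map_add, map_smulₛₗ, hA, hB, conj_trivial, smul_neg, neg_add]
    have hker : e ∈ LinearMap.ker (g 0 • A + g 1 • B) := by
      simpa [hg2] using hsum
    rw [← hrange, ← orthogonal_ker_of_skew hskew] at he
    exact he0 (inner_self_eq_zero.mp (he e hker))

/-- **Rank-two H-like setup, Lemma on eigenspaces.**
`J` encodes an H-like metric two-step nilpotent Lie algebra of `J`-rank two with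
constant `J`-spectrum `{ic, -ic, 0, …, 0}`: each `J z` is skew-adjoint, satisfies
`(J z)³ = -(c²‖z‖²) • (J z)`, and has rank `2` for `z ≠ 0`.  `E z` is the range of
`J z`.  If `z₁, z₂` are linearly independent then `E z₁ ≠ E z₂` and
`E z₁ ⊓ E z₂` is one-dimensional. -/
theorem stmt13 {Z V : Type*}
    [NormedAddCommGroup Z] [InnerProductSpace ℝ Z] [FiniteDimensional ℝ Z]
    [NormedAddCommGroup V] [InnerProductSpace ℝ V] [FiniteDimensional ℝ V]
    (c : ℝ) (hc : 0 < c) (J : Z →ₗ[ℝ] (V →ₗ[ℝ] V))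
    (hskew : ∀ z : Z, LinearMap.adjoint (J z) = -(J z))
    (hcube : ∀ z : Z, (J z) ∘ₗ (J z) ∘ₗ (J z) = -((c ^ 2 * ‖z‖ ^ 2) • (J z)))
    (hrank : ∀ z : Z, z ≠ 0 → finrank ℝ (LinearMap.range (J z)) = 2)
    (z₁ z₂ : Z) (hind : LinearIndependent ℝ ![z₁, z₂]) :
    LinearMap.range (J z₁) ≠ LinearMap.range (J z₂) ∧
    finrank ℝ ↥(LinearMap.range (J z₁) ⊓ LinearMap.range (J z₂)) = 1 := by
  have hcomb {a b : ℝ} (h : ¬(a = 0 ∧ b = 0)) : a • z₁ + b • z₂ ≠ 0 :=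
    fun h0 => h (LinearIndependent.pair_iff.mp hind a b h0)
  have hz₁ : z₁ ≠ 0 := by simpa using hcomb (a := 1) (b := 0) (by simp)
  have hz₂ : z₂ ≠ 0 := by simpa using hcomb (a := 0) (b := 1) (by simp)
  have hne : LinearMap.range (J z₁) ≠ LinearMap.range (J z₂) := by
    intro heq
    obtain ⟨a, b, hab, hrange⟩ :=
      exists_range_smul_add_smul_ne_of_skew (hskew z₁) (hskew z₂) heq (hrank z₁ hz₁)
    refine hrange (Submodule.eq_of_le_of_finrank_eq ?_ ?_)
    · rintro _ ⟨v, rfl⟩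
      exact add_mem (Submodule.smul_mem _ _ ⟨v, rfl⟩)
        (Submodule.smul_mem _ _ (heq ▸ ⟨v, rfl⟩))
    · rw [hrank z₁ hz₁, ← hrank _ (hcomb hab), map_add, map_smul, map_smul]
  refine ⟨hne, ?_⟩
  have hpos : finrank ℝ ↥(LinearMap.range (J z₁) ⊓ LinearMap.range (J z₂)) ≠ 0 := by
    intro h0
    have hle := range_sup_le_range_add_of_skew (hskew z₁) (hskew z₂)
      (Submodule.finrank_eq_zero.mp h0)
    have hz : z₁ + z₂ ≠ 0 := by simpa using hcomb (a := 1) (b := 1) (by simp)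
    have hfin := Submodule.finrank_mono hle
    have hdim := Submodule.finrank_sup_add_finrank_inf_eq
      (LinearMap.range (J z₁)) (LinearMap.range (J z₂))
    rw [← map_add, hrank _ hz] at hfin
    rw [hrank z₁ hz₁, hrank z₂ hz₂] at hdim
    omega
  have hlt : finrank ℝ ↥(LinearMap.range (J z₁) ⊓ LinearMap.range (J z₂)) < 2 := by
    rw [← hrank z₁ hz₁]
    refine Submodule.finrank_lt_finrank_of_lt (inf_le_left.lt_of_ne fun h => hne ?_)
    exact Submodule.eq_of_le_of_finrank_eq (inf_eq_left.mp h)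
      ((hrank z₁ hz₁).trans (hrank z₂ hz₂).symm)
  omega
end
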